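/- Let $\mathbf{k}$ be an algebraically closed field of characteristic $0$. Then the Novikov field $\Lambda^{\min}$ over $\mathbf{k}$ (series $\sum a_i T^{\gamma_i}$ with $\gamma_i \to +\infty$) is algebraically closed. -/

import Mathlib

open Polynomial
set_option linter.unusedSectionVars false

section Gen
variable {K k : Type*} [NontriviallyNormedField K] [IsUltrametricDist K] [CompleteSpace K]
  [Field k] [IsAlgClosed k] [CharZero k] (ι : k →+* K)
  (hι : ∀ c : k, c ≠ 0 → ‖ι c‖ = 1)
  (hres : ∀ x : K, ‖x‖ ≤ 1 → ∃ c : k, ‖x - ι c‖ < 1)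
  (hsurj : ∀ r : ℝ, 0 < r → ∃ x : K, ‖x‖ = r)
  {E : Type*} [Field E] [Algebra K E] [FiniteDimensional K E]

include hι in
theorem gen_le_one (c : k) : ‖ι c‖ ≤ 1 := by
  by_cases h : c = 0
  · simp [h]
  · exact (hι c h).le

include hι hres in
theorem gen_key (b : E) (hb : spectralNorm K E b ≤ 1) :
    ∃ c : k, spectralNorm K E (b - algebraMap K E (ι c)) < 1 := by
  have hint : IsIntegral K b := Algebra.IsIntegral.isIntegral b
  have hmon := minpoly.monic hint
  have hco := (spectralValue_le_one_iff hmon).1 hb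
  choose c hc using fun i => hres _ (hco i)
  set f := minpoly K b with hf
  set n := f.natDegree with hn
  have hn0 : 0 < n := minpoly.natDegree_pos hint
  let g : k[X] := ∑ i ∈ Finset.range (n + 1), monomial i (c i)
  have hgn : g.coeff n = c n := by
    simp [g, coeff_monomial]
  have hcn : c n ≠ 0 := by
    intro h0
    have := hc n
    rw [h0, map_zero, sub_zero, hn, hmon.coeff_natDegree, norm_one] at this
    exact lt_irrefl _ this
  have hgdeg : g.degree ≠ 0 := by
    intro h0
    have := coeff_eq_zero_of_degree_lt (p := g) (n := n) (by rw [h0]; exact_mod_cast hn0)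
    exact hcn (hgn ▸ this)
  obtain ⟨r, hr⟩ := IsAlgClosed.exists_root g hgdeg
  refine ⟨r, ?_⟩
  have h1 : f.eval (ι r) = ∑ i ∈ Finset.range (n + 1), (f.coeff i - ι (c i)) * (ι r) ^ i := by
    have h2 : ∑ i ∈ Finset.range (n + 1), ι (c i) * (ι r) ^ i = 0 := by
      have : g.eval r = 0 := hr
      simp only [g, eval_finsetSum, eval_monomial] at this
      have := congrArg ι this
      simpa [map_sum] using this
    rw [eval_eq_sum_range]
    simp only [sub_mul, Finset.sum_sub_distrib]
    rw [h2, sub_zero]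
  have h3 : ‖f.eval (ι r)‖ < 1 := by
    rw [h1]
    obtain ⟨i, hi, hle⟩ := IsUltrametricDist.exists_norm_finsetSum_le_of_nonempty
      (t := Finset.range (n + 1)) ⟨0, by simp⟩ (fun i => (f.coeff i - ι (c i)) * (ι r) ^ i)
    refine hle.trans_lt ?_
    rw [norm_mul, norm_pow]
    exact mul_lt_one_of_nonneg_of_lt_one_left (norm_nonneg _) (hc i)
      (pow_le_one₀ (norm_nonneg _) (gen_le_one ι hι r))
  rw [spectralNorm.spectralNorm_eq_norm_coeff_zero_rpow, minpoly.sub_algebraMap]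
  rw [coeff_zero_eq_eval_zero, eval_comp]
  simp only [eval_add, eval_X, eval_C, zero_add]
  apply Real.rpow_lt_one (norm_nonneg _) h3
  have : 0 < ((minpoly K b).comp (X + C (ι r))).natDegree := by
    rw [natDegree_comp, natDegree_X_add_C, mul_one]; exact hn0
  positivity

include hι hres hsurj in
theorem gen_key2 (b : E) (hb : b ≠ 0) :
    ∃ d : K, spectralNorm K E (b - algebraMap K E d) < spectralNorm K E b := by
  have hpos := spectralNorm_zero_lt hb (Algebra.IsAlgebraic.isAlgebraic (R := K) b)
  obtain ⟨t, ht⟩ := hsurj _ hpos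
  have ht0 : t ≠ 0 := by rintro rfl; simp at ht; linarith
  have mulE : ∀ x y : E, spectralNorm K E (x * y) = spectralNorm K E x * spectralNorm K E y :=
    fun x y => map_mul (spectralMulAlgNorm K E) x y
  have htE : algebraMap K E t ≠ 0 := by simpa using ht0
  have e1 : b = algebraMap K E t * (algebraMap K E t⁻¹ * b) := by
    rw [map_inv₀, mul_inv_cancel_left₀ htE]
  obtain ⟨c, hc⟩ := gen_key ι hι hres (algebraMap K E t⁻¹ * b) (by
    rw [mulE, spectralNorm_extends, norm_inv, ht, inv_mul_cancel₀ hpos.ne'])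
  refine ⟨t * ι c, ?_⟩
  have e2 : b - algebraMap K E (t * ι c)
      = algebraMap K E t * (algebraMap K E t⁻¹ * b - algebraMap K E (ι c)) := by
    rw [mul_sub, ← e1, map_mul]
  rw [e2, mulE, spectralNorm_extends, ht]
  exact mul_lt_of_lt_one_right hpos hc

include hι in
theorem gen_natCast (n : ℕ) (hn : n ≠ 0) : ‖(n : K)‖ = 1 := by
  rw [← map_natCast ι]; exact hι _ (by exact_mod_cast hn)

theorem gen_trace (x : E) : ‖Algebra.trace K E x‖ ≤ spectralNorm K E x := by
  rw [trace_eq_finrank_mul_minpoly_nextCoeff, norm_mul, norm_neg]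
  have h1 := IsUltrametricDist.norm_natCast_le_one K (Module.finrank (IntermediateField.adjoin K {x}) E)
  have hint : IsIntegral K x := Algebra.IsIntegral.isIntegral x
  have hn0 : 0 < (minpoly K x).natDegree := minpoly.natDegree_pos hint
  have h2 : ‖(minpoly K x).nextCoeff‖ ≤ spectralNorm K E x := by
    have := le_ciSup (spectralValueTerms_bddAbove (minpoly K x)) ((minpoly K x).natDegree - 1)
    rw [spectralValueTerms_of_lt_natDegree _ (by omega)] at this
    rw [nextCoeff_of_natDegree_pos hn0]
    rw [Nat.cast_sub (show 1 ≤ _ from hn0)] at this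
    unfold spectralNorm spectralValue
    simpa using this
  calc _ ≤ 1 * _ := mul_le_mul h1 h2 (norm_nonneg _) zero_le_one
    _ = _ := one_mul _

include hι hres hsurj in
theorem gen_surj (x : E) : ∃ y : K, algebraMap K E y = x := by
  set N := Module.finrank K E with hN
  have hN0 : N ≠ 0 := Module.finrank_pos.ne'
  have hNn := gen_natCast ι hι N hN0
  have hNK : (N : K) ≠ 0 := by intro h; rw [h] at hNn; simp at hNn
  refine ⟨Algebra.trace K E x / N, ?_⟩
  by_contra hne
  set b := x - algebraMap K E (Algebra.trace K E x / N) with hb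
  have hb0 : b ≠ 0 := sub_ne_zero.2 (Ne.symm hne)
  have htr : Algebra.trace K E b = 0 := by
    rw [hb, map_sub, Algebra.trace_algebraMap, nsmul_eq_mul, ← hN, mul_div_cancel₀ _ hNK, sub_self]
  obtain ⟨d, hd⟩ := gen_key2 ι hι hres hsurj b hb0
  have h1 := gen_trace (K := K) (b - algebraMap K E d)
  rw [map_sub, htr, Algebra.trace_algebraMap, nsmul_eq_mul, ← hN, zero_sub, norm_neg, norm_mul, hNn,
    one_mul] at h1
  have h2 := isNonarchimedean_spectralNorm (K := K) (b - algebraMap K E d) (algebraMap K E d)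
  rw [sub_add_cancel, spectralNorm_extends] at h2
  exact absurd h2 (not_le.2 (max_lt hd (h1.trans_lt hd)))

include hι hres hsurj in
theorem gen_isAlgClosed : IsAlgClosed K := by
  apply IsAlgClosed.of_exists_root
  intro p hp hirr
  have : Fact (Irreducible p) := ⟨hirr⟩
  have : FiniteDimensional K (AdjoinRoot p) := (AdjoinRoot.powerBasis hirr.ne_zero).finite
  obtain ⟨y, hy⟩ := gen_surj (E := AdjoinRoot p) ι hι hres hsurj (AdjoinRoot.root p)
  refine ⟨y, ?_⟩
  have := AdjoinRoot.eval₂_root p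
  rw [← hy, ← AdjoinRoot.algebraMap_eq, eval₂_at_apply] at this
  simpa using this
end Gen

section Nov
variable {k : Type*} [Field k]

noncomputable def hnorm (x : HahnSeries ℝ k) : ℝ := by
  classical exact if x = 0 then 0 else Real.exp (-x.order)

theorem hnorm_zero : hnorm (0 : HahnSeries ℝ k) = 0 := by simp [hnorm]
theorem hnorm_of_ne {x : HahnSeries ℝ k} (h : x ≠ 0) : hnorm x = Real.exp (-x.order) := by
  simp [hnorm, h]

theorem hnorm_nonneg (x : HahnSeries ℝ k) : 0 ≤ hnorm x := by
  by_cases h : x = 0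
  · rw [h, hnorm_zero]
  · rw [hnorm_of_ne h]; positivity

theorem hnorm_mul (x y : HahnSeries ℝ k) : hnorm (x * y) = hnorm x * hnorm y := by
  by_cases hx : x = 0
  · simp [hx, hnorm_zero]
  by_cases hy : y = 0
  · simp [hy, hnorm_zero]
  rw [hnorm_of_ne hx, hnorm_of_ne hy, hnorm_of_ne (mul_ne_zero hx hy), HahnSeries.order_mul hx hy,
    ← Real.exp_add]
  congr 1; ring

theorem hnorm_lt_iff (x : HahnSeries ℝ k) (c : ℝ) :
    hnorm x < Real.exp (-c) ↔ ∀ g ≤ c, x.coeff g = 0 := by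
  by_cases hx : x = 0
  · simp [hx, hnorm_zero, Real.exp_pos]
  rw [hnorm_of_ne hx, Real.exp_lt_exp, neg_lt_neg_iff]
  constructor
  · intro h g hg
    exact HahnSeries.coeff_eq_zero_of_lt_order (hg.trans_lt h)
  · intro h
    by_contra hc
    exact hx (HahnSeries.coeff_order_eq_zero.1 (h _ (not_lt.1 hc)))

theorem hnorm_le_iff (x : HahnSeries ℝ k) (c : ℝ) :
    hnorm x ≤ Real.exp (-c) ↔ ∀ g < c, x.coeff g = 0 := by
  by_cases hx : x = 0
  · simp [hx, hnorm_zero, Real.exp_nonneg]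
  rw [hnorm_of_ne hx, Real.exp_le_exp, neg_le_neg_iff]
  constructor
  · intro h g hg
    exact HahnSeries.coeff_eq_zero_of_lt_order (hg.trans_le h)
  · intro h
    by_contra hc
    exact hx (HahnSeries.coeff_order_eq_zero.1 (h _ (not_le.1 hc)))

theorem hnorm_add (x y : HahnSeries ℝ k) : hnorm (x + y) ≤ max (hnorm x) (hnorm y) := by
  by_cases hx : x = 0
  · simp [hx]
  by_cases hy : y = 0
  · simp [hy]
  have key : ∀ c, hnorm x ≤ Real.exp (-c) → hnorm y ≤ Real.exp (-c) →
      hnorm (x + y) ≤ Real.exp (-c) := by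
    intro c h1 h2
    rw [hnorm_le_iff] at *
    intro g hg
    rw [HahnSeries.coeff_add, h1 g hg, h2 g hg, add_zero]
  rcases le_total (hnorm x) (hnorm y) with h | h
  · rw [max_eq_right h]
    have e := hnorm_of_ne hy
    rw [e] at h ⊢
    exact key _ h e.le
  · rw [max_eq_left h]
    have e := hnorm_of_ne hx
    rw [e] at h ⊢
    exact key _ e.le h

theorem hnorm_single (a : ℝ) (r : k) (hr : r ≠ 0) :
    hnorm (HahnSeries.single a r) = Real.exp (-a) := by
  rw [hnorm_of_ne (by simpa using hr), HahnSeries.order_single hr]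

noncomputable def habs (k : Type*) [Field k] : AbsoluteValue (HahnSeries ℝ k) ℝ where
  toFun := hnorm
  map_mul' := hnorm_mul
  nonneg' := hnorm_nonneg
  eq_zero' x := by
    refine ⟨fun h => ?_, fun h => by rw [h, hnorm_zero]⟩
    by_contra hx
    rw [hnorm_of_ne hx] at h
    exact (Real.exp_pos _).ne' h
  add_le' x y := (hnorm_add x y).trans
    (max_le_add_of_nonneg (hnorm_nonneg x) (hnorm_nonneg y))

def IsNov (x : HahnSeries ℝ k) : Prop := ∀ c : ℝ, (x.support ∩ Set.Iic c).Finite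

theorem isNov_approx (x : HahnSeries ℝ k)
    (h : ∀ c : ℝ, ∃ w, IsNov w ∧ hnorm (x - w) < Real.exp (-c)) : IsNov x := by
  intro c
  obtain ⟨w, hw, hxw⟩ := h c
  rw [hnorm_lt_iff] at hxw
  refine (hw c).subset ?_
  rintro g ⟨hg, hgc⟩
  refine ⟨?_, hgc⟩
  have := hxw g hgc
  rw [HahnSeries.coeff_sub, sub_eq_zero] at this
  rw [HahnSeries.mem_support] at *
  rwa [← this]

theorem isNov_single (a : ℝ) (r : k) : IsNov (HahnSeries.single a r) := fun _ =>
  ((Set.finite_singleton a).subset HahnSeries.support_single_subset).subset Set.inter_subset_left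

theorem isNov_add {x y : HahnSeries ℝ k} (hx : IsNov x) (hy : IsNov y) : IsNov (x + y) := by
  intro c
  refine ((hx c).union (hy c)).subset ?_
  rintro g ⟨hg, hgc⟩
  rcases HahnSeries.support_add_subset _ _ hg with h | h
  · exact Or.inl ⟨h, hgc⟩
  · exact Or.inr ⟨h, hgc⟩

theorem isNov_neg {x : HahnSeries ℝ k} (hx : IsNov x) : IsNov (-x) := by
  intro c
  simpa using hx c

theorem isNov_mul {x y : HahnSeries ℝ k} (hx : IsNov x) (hy : IsNov y) : IsNov (x * y) := by
  intro c
  refine ((hx (c - y.order)).add (hy (c - x.order))).subset ?_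
  rintro g ⟨hg, hgc⟩
  obtain ⟨a, ha, b, hb, rfl⟩ := HahnSeries.support_mul_subset hg
  have h1 := HahnSeries.order_le_of_coeff_ne_zero ha
  have h2 := HahnSeries.order_le_of_coeff_ne_zero hb
  simp only [Set.mem_Iic] at hgc
  exact Set.add_mem_add ⟨ha, by simp only [Set.mem_Iic]; linarith⟩
    ⟨hb, by simp only [Set.mem_Iic]; linarith⟩

noncomputable def novSubring (k : Type*) [Field k] : Subring (HahnSeries ℝ k) where
  carrier := {x | IsNov x}
  mul_mem' := isNov_mul
  one_mem' := isNov_single 0 1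
  add_mem' := isNov_add
  zero_mem' := by intro c; simp
  neg_mem' := isNov_neg

theorem isNov_inv {x : HahnSeries ℝ k} (hx : IsNov x) : IsNov x⁻¹ := by
  by_cases hx0 : x = 0
  · rw [hx0, inv_zero]; exact (novSubring k).zero_mem
  have hl : x.coeff x.order ≠ 0 := fun h => hx0 (HahnSeries.coeff_order_eq_zero.1 h)
  set s : HahnSeries ℝ k := HahnSeries.single (-x.order) (x.coeff x.order)⁻¹ with hs
  have hs0 : s ≠ 0 := by simpa [hs] using hl
  set u : HahnSeries ℝ k := 1 - x * s with hu
  have huN : u ∈ novSubring k :=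
    (novSubring k).sub_mem (novSubring k).one_mem
      ((novSubring k).mul_mem hx (isNov_single _ _))
  have hu1 : hnorm u < 1 := by
    have := (hnorm_lt_iff u 0).2 ?_
    · simpa using this
    intro g hg
    have e : (x * s).coeff g = x.coeff (g + x.order) * (x.coeff x.order)⁻¹ := by
      have := HahnSeries.coeff_mul_single_add (r := (x.coeff x.order)⁻¹) (x := x)
        (a := g + x.order) (b := - x.order)
      simpa [hs] using this
    rw [hu, HahnSeries.coeff_sub, e]
    rcases hg.lt_or_eq with h | h
    · rw [HahnSeries.coeff_eq_zero_of_lt_order (x := x) (by linarith), HahnSeries.coeff_one]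
      simp [h.ne]
    · subst h
      simp [hl]
  set z := (x * s)⁻¹ with hz
  have hxs : x * s ≠ 0 := mul_ne_zero hx0 hs0
  have hzN : IsNov z := by
    apply isNov_approx
    intro c
    have hlim : Filter.Tendsto (fun N : ℕ => hnorm u ^ N * hnorm z) Filter.atTop (nhds 0) := by
      simpa using (tendsto_pow_atTop_nhds_zero_of_lt_one (hnorm_nonneg u) hu1).mul_const (hnorm z)
    obtain ⟨N, hN⟩ := (hlim.eventually (gt_mem_nhds (Real.exp_pos (-c)))).exists
    refine ⟨∑ i ∈ Finset.range N, u ^ i,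
      (novSubring k).sum_mem fun i _ => (novSubring k).pow_mem huN i, ?_⟩
    have e : z - ∑ i ∈ Finset.range N, u ^ i = u ^ N * z := by
      have g1 := mul_neg_geom_sum u N
      have g2 : 1 - u = x * s := by rw [hu]; ring
      rw [g2] at g1
      apply mul_left_cancel₀ hxs
      rw [mul_sub, g1, mul_left_comm, hz, mul_inv_cancel₀ hxs]
      ring
    rw [e, hnorm_mul]
    change habs k (u ^ N) * _ < _
    rw [map_pow]
    exact hN
  have : x⁻¹ = s * z := by
    rw [hz, mul_inv, mul_left_comm, mul_inv_cancel₀ hs0, mul_one]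
  rw [this]
  exact isNov_mul (isNov_single _ _) hzN

noncomputable def nov (k : Type*) [Field k] : Subfield (HahnSeries ℝ k) where
  __ := novSubring k
  inv_mem' _ := isNov_inv

@[reducible] noncomputable def novNormedField (k : Type*) [Field k] : NormedField (nov k) :=
  ((habs k).comp (f := (nov k).subtype) Subtype.val_injective).toNormedField

noncomputable instance novNontriviallyNormedField (k : Type*) [Field k] :
    NontriviallyNormedField (nov k) where
  __ := novNormedField k
  non_trivial := by
    refine ⟨⟨HahnSeries.single (-1) 1, isNov_single _ _⟩, ?_⟩
    change 1 < hnorm (HahnSeries.single (-1) (1 : k))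
    rw [hnorm_single _ _ one_ne_zero]
    simp

theorem nov_norm (x : nov k) : ‖x‖ = hnorm (x : HahnSeries ℝ k) := rfl

instance : IsUltrametricDist (nov k) :=
  IsUltrametricDist.isUltrametricDist_of_forall_norm_add_le_max_norm
    fun x y => hnorm_add (x : HahnSeries ℝ k) y

theorem isPWO_of_fin {s : Set ℝ} (h : ∀ c, (s ∩ Set.Iic c).Finite) : s.IsPWO := by
  rw [Set.isPWO_iff_isWF, Set.isWF_iff_no_descending_seq]
  intro f hf hs
  have hinf : (Set.range f).Infinite := Set.infinite_range_of_injective hf.injective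
  apply hinf
  refine (h (f 0)).subset ?_
  rintro _ ⟨n, rfl⟩
  exact ⟨hs n, hf.antitone (Nat.zero_le n)⟩

instance : CompleteSpace (nov k) := by
  apply Metric.complete_of_cauchySeq_tendsto
  intro u hu
  have h1 : ∀ c : ℝ, ∃ N : ℕ, ∀ n ≥ N, ∀ g ≤ c,
      (u n : HahnSeries ℝ k).coeff g = (u N : HahnSeries ℝ k).coeff g := by
    intro c
    obtain ⟨N, hN⟩ := Metric.cauchySeq_iff'.1 hu (Real.exp (-c)) (Real.exp_pos _)
    refine ⟨N, fun n hn g hg => ?_⟩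
    have := hN n hn
    rw [dist_eq_norm, nov_norm, hnorm_lt_iff] at this
    have := this g hg
    rw [Subfield.coe_sub, HahnSeries.coeff_sub, sub_eq_zero] at this
    exact this
  choose N hN using h1
  let f : ℝ → k := fun g => (u (N g) : HahnSeries ℝ k).coeff g
  have hf : ∀ c, ∀ g ≤ c, f g = (u (N c) : HahnSeries ℝ k).coeff g := by
    intro c g hg
    rw [← hN c (max (N c) (N g)) (le_max_left _ _) g hg,
      hN g (max (N c) (N g)) (le_max_right _ _) g le_rfl]
  have hfin : ∀ c, (Function.support f ∩ Set.Iic c).Finite := by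
    intro c
    refine ((u (N c)).2 c).subset ?_
    rintro g ⟨hg, hgc⟩
    refine ⟨?_, hgc⟩
    rw [HahnSeries.mem_support, ← hf c g hgc]
    exact hg
  let L : nov k := ⟨⟨f, isPWO_of_fin hfin⟩, hfin⟩
  refine ⟨L, ?_⟩
  rw [Metric.tendsto_atTop]
  intro ε hε
  refine ⟨N (-Real.log ε), fun n hn => ?_⟩
  rw [dist_eq_norm, nov_norm]
  have : ε = Real.exp (-(-Real.log ε)) := by rw [neg_neg, Real.exp_log hε]
  rw [this, hnorm_lt_iff]
  intro g hg
  rw [Subfield.coe_sub, HahnSeries.coeff_sub, sub_eq_zero, hN _ n hn g hg, ← hf _ g hg]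

theorem nov_isAlgClosed [IsAlgClosed k] [CharZero k] : IsAlgClosed (nov k) := by
  let ι : k →+* nov k := (HahnSeries.C : k →+* HahnSeries ℝ k).codRestrict (nov k)
    (fun c => isNov_single 0 c)
  have hι : ∀ c, ((ι c : nov k) : HahnSeries ℝ k) = HahnSeries.single 0 c := fun c => rfl
  apply gen_isAlgClosed ι
  · intro c hc
    rw [nov_norm, hι, hnorm_single _ _ hc]; simp
  · intro x hx
    refine ⟨(x : HahnSeries ℝ k).coeff 0, ?_⟩
    rw [nov_norm] at *
    have e : (1 : ℝ) = Real.exp (-0) := by simp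
    rw [e, hnorm_lt_iff]
    rw [e, hnorm_le_iff] at hx
    intro g hg
    rw [Subfield.coe_sub, HahnSeries.coeff_sub, hι]
    rcases hg.lt_or_eq with h | h
    · rw [hx g h, HahnSeries.coeff_single_of_ne h.ne, sub_zero]
    · subst h; simp
  · intro r hr
    refine ⟨⟨HahnSeries.single (-Real.log r) 1, isNov_single _ _⟩, ?_⟩
    rw [nov_norm, hnorm_single _ _ one_ne_zero, neg_neg, Real.exp_log hr]
end Nov

/-- If `k` is an algebraically closed field of characteristic `0`, then the Novikov
field `Λ^min` over `k` — realized inside the Hahn series field `HahnSeries ℝ k` as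
those series whose support meets every `(-∞, c]` in a finite set — is algebraically
closed: every polynomial of positive degree with Novikov coefficients has a Novikov
root. -/
theorem stmt19 {k : Type*} [Field k] [IsAlgClosed k] [CharZero k]
    (P : Polynomial (HahnSeries ℝ k))
    (hcoeff : ∀ i : ℕ, ∀ c : ℝ, ((P.coeff i).support ∩ Set.Iic c).Finite)
    (hdeg : 0 < P.degree) :
    ∃ x : HahnSeries ℝ k, (∀ c : ℝ, (x.support ∩ Set.Iic c).Finite) ∧
      P.IsRoot x := by
  have hcl : IsAlgClosed (nov k) := nov_isAlgClosed
  obtain ⟨Q, hQ⟩ : ∃ Q : Polynomial (nov k), Q.map (nov k).subtype = P := by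
    have : P ∈ Polynomial.lifts (nov k).subtype := by
      rw [Polynomial.lifts_iff_coeff_lifts]
      intro n
      exact ⟨⟨P.coeff n, hcoeff n⟩, rfl⟩
    exact (Polynomial.mem_lifts _).1 this
  have hd : Q.degree ≠ 0 := by
    rw [← hQ, Polynomial.degree_map] at hdeg
    exact hdeg.ne'
  obtain ⟨y, hy⟩ := IsAlgClosed.exists_root Q hd
  refine ⟨y, y.2, ?_⟩
  rw [← hQ]
  exact hy.map (f := (nov k).subtype)
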